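/- arXiv:2508.13753 — 2 statements merged into one kernel-verified Lean document; each statement's English description precedes it below -/
import Mathlib

section
/- Let Λ be a 2×2 real matrix with 2|det Λ| < |Λ|², and let s ∈ (-1,1). Then the inequality (Λ : M)² ≤ |M|² + 2s·det M holds for all 2×2 matrices M if and only if (|Λ|² - 2s·det Λ)/(1 - s²) ≤ 1. -/
noncomputable def frobSq (M : Matrix (Fin 2) (Fin 2) ℝ) : ℝ := ∑ i, ∑ j, (M i j)^2

noncomputable def dotp (M N : Matrix (Fin 2) (Fin 2) ℝ) : ℝ := ∑ i, ∑ j, M i j * N i j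

theorem frobSq_add_det_nonneg {s : ℝ} (hs : s ∈ Set.Ioo (-1 : ℝ) 1)
    (M : Matrix (Fin 2) (Fin 2) ℝ) : 0 ≤ frobSq M + 2 * s * M.det := by
  obtain ⟨h1, h2⟩ := hs
  have hp : 0 ≤ (1 + s) * ((M 0 0 + M 1 1) ^ 2 + (M 0 1 - M 1 0) ^ 2) :=
    mul_nonneg (by linarith) (by positivity)
  have hm : 0 ≤ (1 - s) * ((M 0 0 - M 1 1) ^ 2 + (M 0 1 + M 1 0) ^ 2) :=
    mul_nonneg (by linarith) (by positivity)
  simp only [frobSq, Fin.sum_univ_two, Matrix.det_fin_two]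
  linarith

/-- The matrix representing `dotp Λ`, up to the factor `1 - s ^ 2`, in the inner product
whose quadratic form is `frobSq M + 2 * s * M.det`. -/
def dotpRepresenter (Λ : Matrix (Fin 2) (Fin 2) ℝ) (s : ℝ) : Matrix (Fin 2) (Fin 2) ℝ :=
  Λ - s • Λ.adjugate.transpose

theorem dotp_dotpRepresenter (Λ : Matrix (Fin 2) (Fin 2) ℝ) (s : ℝ) :
    dotp Λ (dotpRepresenter Λ s) = frobSq Λ - 2 * s * Λ.det := by
  simp [dotp, dotpRepresenter, frobSq, Fin.sum_univ_two, Matrix.det_fin_two,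
    Matrix.adjugate_fin_two]
  ring

theorem frobSq_add_det_smul_dotpRepresenter_sub (Λ M : Matrix (Fin 2) (Fin 2) ℝ) (s t u : ℝ) :
    frobSq (t • dotpRepresenter Λ s - u • M) + 2 * s * (t • dotpRepresenter Λ s - u • M).det =
      t ^ 2 * ((1 - s ^ 2) * (frobSq Λ - 2 * s * Λ.det)) - 2 * t * u * ((1 - s ^ 2) * dotp Λ M) +
        u ^ 2 * (frobSq M + 2 * s * M.det) := by
  simp [dotp, dotpRepresenter, frobSq, Fin.sum_univ_two, Matrix.det_fin_two,
    Matrix.adjugate_fin_two]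
  ring

theorem quadratic_form_criterion (Λ : Matrix (Fin 2) (Fin 2) ℝ)
    (hdet : 2 * |Λ.det| < frobSq Λ) (s : ℝ) (hs : s ∈ Set.Ioo (-1 : ℝ) 1) :
    (∀ M : Matrix (Fin 2) (Fin 2) ℝ, (dotp Λ M)^2 ≤ frobSq M + 2 * s * M.det) ↔
      (frobSq Λ - 2 * s * Λ.det) / (1 - s^2) ≤ 1 := by
  have hs2 : 0 < 1 - s ^ 2 := by nlinarith [hs.1, hs.2]
  have hP : 0 < frobSq Λ - 2 * s * Λ.det := by
    have h : s * Λ.det ≤ |Λ.det| := by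
      calc s * Λ.det ≤ |s| * |Λ.det| := (le_abs_self _).trans (abs_mul _ _).le
        _ ≤ |Λ.det| := mul_le_of_le_one_left (abs_nonneg _) (abs_lt.mpr hs).le
    linarith
  rw [div_le_one hs2]
  constructor
  · intro h
    have h0 := h (dotpRepresenter Λ s)
    have h1 := frobSq_add_det_smul_dotpRepresenter_sub Λ 0 s 1 0
    simp only [one_smul, zero_smul, sub_zero] at h1
    rw [dotp_dotpRepresenter, h1] at h0
    exact le_of_mul_le_mul_right (by linarith) hP
  · intro h M
    have h0 := frobSq_add_det_nonneg hs
      (dotp Λ M • dotpRepresenter Λ s - (frobSq Λ - 2 * s * Λ.det) • M)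
    rw [frobSq_add_det_smul_dotpRepresenter_sub] at h0
    have hQ := frobSq_add_det_nonneg hs M
    generalize frobSq M + 2 * s * M.det = Q at *
    generalize frobSq Λ - 2 * s * Λ.det = P at *
    have h1 : (1 - s ^ 2) * dotp Λ M ^ 2 ≤ P * Q :=
      le_of_mul_le_mul_left (by linarith) hP
    exact le_of_mul_le_mul_left (h1.trans (mul_le_mul_of_nonneg_right h hQ)) hs2
end

section
/- There exists a polynomial P : ℝ² → ℝ, namely P(y) = |y|²/2 - |y|⁴/12 - y₁²y₂²/3, such that |∂²P/∂y₁²(y)| ≤ |1 - |y|²| and |∂²P/∂y₂²(y)| ≤ |1 - |y|²| for all y ∈ ℝ², and ∂²P/∂y₂²(0, y₂) = 1 - y₂² for all y₂ ∈ ℝ. -/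
noncomputable def Ppoly (y₁ y₂ : ℝ) : ℝ :=
  (y₁^2 + y₂^2) / 2 - (y₁^2 + y₂^2)^2 / 12 - y₁^2 * y₂^2 / 3

theorem Ppoly_comm (a b : ℝ) : Ppoly a b = Ppoly b a := by
  unfold Ppoly
  ring

theorem hasDerivAt_Ppoly_left (a b : ℝ) :
    HasDerivAt (fun u => Ppoly u b) (a - a ^ 3 / 3 - a * b ^ 2) a := by
  have h := hasDerivAt_pow 2 a
  have hs := h.add_const (b ^ 2)
  exact (((hs.div_const 2).sub ((hs.pow 2).div_const 12)).sub
    ((h.mul_const (b ^ 2)).div_const 3)).congr_deriv (by simp; ring)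

theorem deriv_deriv_Ppoly_left (a b : ℝ) :
    deriv (fun t => deriv (fun u => Ppoly u b) t) a = 1 - (a ^ 2 + b ^ 2) := by
  simp_rw [fun t => (hasDerivAt_Ppoly_left t b).deriv]
  exact ((((hasDerivAt_id a).sub ((hasDerivAt_pow 3 a).div_const 3)).sub
    ((hasDerivAt_id a).mul_const (b ^ 2))).congr_deriv (by simp; ring)).deriv

theorem deriv_deriv_Ppoly_right (a b : ℝ) :
    deriv (fun t => deriv (fun u => Ppoly a u) t) b = 1 - (a ^ 2 + b ^ 2) := by
  simp_rw [Ppoly_comm a]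
  rw [deriv_deriv_Ppoly_left, add_comm]

theorem Ppoly_second_derivatives :
    (∀ y₁ y₂ : ℝ,
      |deriv (fun t => deriv (fun u => Ppoly u y₂) t) y₁| ≤ |1 - (y₁^2 + y₂^2)|) ∧
    (∀ y₁ y₂ : ℝ,
      |deriv (fun t => deriv (fun u => Ppoly y₁ u) t) y₂| ≤ |1 - (y₁^2 + y₂^2)|) ∧
    (∀ y₂ : ℝ, deriv (fun t => deriv (fun u => Ppoly 0 u) t) y₂ = 1 - y₂^2) := by
  refine ⟨fun y₁ y₂ => ?_, fun y₁ y₂ => ?_, fun y₂ => ?_⟩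
  · rw [deriv_deriv_Ppoly_left]
  · rw [deriv_deriv_Ppoly_right]
  · rw [deriv_deriv_Ppoly_right]
    ring
end
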